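/- arXiv:math/9904023 — 3 statements merged into one kernel-verified Lean document; each statement's English description precedes it below -/
import Mathlib

section
/- The difference Ramsey number D(3, 4) equals 9: for every B ⊆ {1, …, 8} the difference coloring of the complete graph on {1, …, 9} contains a blue K_3 or a red K_4, and there exists B ⊆ {1, …, 7} such that the difference coloring of the complete graph on {1, …, 8} contains neither a blue K_3 nor a red K_4. -/
/-- A blue `m`-clique of the difference coloring of `K_n` determined by `B`: a set of `m`
vertices in `{1, …, n}` all of whose pairwise differences lie in `B`. -/
def HasBlueClique (B : Set ℕ) (n m : ℕ) : Prop :=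
  ∃ V : Finset ℕ, (∀ v ∈ V, 1 ≤ v ∧ v ≤ n) ∧ V.card = m ∧
    ∀ i ∈ V, ∀ j ∈ V, i < j → j - i ∈ B

/-- A red `m`-clique of the difference coloring of `K_n` determined by `B`: a set of `m`
vertices in `{1, …, n}` none of whose pairwise differences lie in `B`. -/
def HasRedClique (B : Set ℕ) (n m : ℕ) : Prop :=
  ∃ V : Finset ℕ, (∀ v ∈ V, 1 ≤ v ∧ v ≤ n) ∧ V.card = m ∧
    ∀ i ∈ V, ∀ j ∈ V, i < j → j - i ∉ B

/-- The difference Ramsey number `D(k, l)`: the least `N` such that for every set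
`B ⊆ {1, …, N-1}` of blue differences, the difference coloring of `K_N` contains a blue
`K_k` or a red `K_l`. -/
noncomputable def diffRamseyNumber (k l : ℕ) : ℕ :=
  sInf {N | ∀ B : Set ℕ, B ⊆ Set.Icc 1 (N - 1) →
    HasBlueClique B N k ∨ HasRedClique B N l}

theorem blue_of (B : Set ℕ) (hn : ¬ HasBlueClique B 9 3) (a b : ℕ) (ha : 1 ≤ a) (hb : 1 ≤ b)
    (hs : a + b ≤ 8) : ¬ (a ∈ B ∧ b ∈ B ∧ a + b ∈ B) := by
  rintro ⟨h1, h2, h3⟩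
  refine hn ⟨{1, 1 + a, 1 + a + b}, ?_, ?_, ?_⟩
  · intro v hv
    simp only [Finset.mem_insert, Finset.mem_singleton] at hv
    omega
  · rw [Finset.card_eq_three]
    exact ⟨1, 1 + a, 1 + a + b, by omega, by omega, by omega, rfl⟩
  · intro i hi j hj hij
    simp only [Finset.mem_insert, Finset.mem_singleton] at hi hj
    have : j - i = a ∨ j - i = b ∨ j - i = a + b := by omega
    rcases this with h | h | h <;> rw [h] <;> assumption

theorem red_of (B : Set ℕ) (hn : ¬ HasRedClique B 9 4) (a b c : ℕ) (ha : 1 ≤ a) (hb : 1 ≤ b)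
    (hc : 1 ≤ c) (hs : a + b + c ≤ 8) :
    a ∈ B ∨ b ∈ B ∨ c ∈ B ∨ a + b ∈ B ∨ b + c ∈ B ∨ a + b + c ∈ B := by
  by_contra hcon
  push Not at hcon
  obtain ⟨h1, h2, h3, h4, h5, h6⟩ := hcon
  refine hn ⟨{1, 1 + a, 1 + a + b, 1 + a + b + c}, ?_, ?_, ?_⟩
  · intro v hv
    simp only [Finset.mem_insert, Finset.mem_singleton] at hv
    omega
  · rw [Finset.card_insert_of_notMem, Finset.card_eq_three.mpr]
    · exact ⟨1 + a, 1 + a + b, 1 + a + b + c, by omega, by omega, by omega, rfl⟩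
    · simp only [Finset.mem_insert, Finset.mem_singleton]
      omega
  · intro i hi j hj hij
    simp only [Finset.mem_insert, Finset.mem_singleton] at hi hj
    have : j - i = a ∨ j - i = b ∨ j - i = c ∨ j - i = a + b ∨ j - i = b + c ∨
        j - i = a + b + c := by omega
    rcases this with h | h | h | h | h | h <;> rw [h] <;> assumption

theorem upper_bound (B : Set ℕ) (_hB : B ⊆ Set.Icc 1 8) :
    HasBlueClique B 9 3 ∨ HasRedClique B 9 4 := by
  by_contra hcon
  push Not at hcon
  obtain ⟨hb, hr⟩ := hcon
  have k0 := blue_of B hb 1 1 (by omega) (by omega) (by omega)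
  have k1 := blue_of B hb 1 3 (by omega) (by omega) (by omega)
  have k2 := blue_of B hb 1 4 (by omega) (by omega) (by omega)
  have k3 := blue_of B hb 1 5 (by omega) (by omega) (by omega)
  have k4 := blue_of B hb 1 6 (by omega) (by omega) (by omega)
  have k5 := blue_of B hb 2 2 (by omega) (by omega) (by omega)
  have k6 := blue_of B hb 2 3 (by omega) (by omega) (by omega)
  have k7 := blue_of B hb 2 5 (by omega) (by omega) (by omega)
  have k8 := blue_of B hb 2 6 (by omega) (by omega) (by omega)
  have k9 := blue_of B hb 3 3 (by omega) (by omega) (by omega)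
  have k10 := blue_of B hb 3 4 (by omega) (by omega) (by omega)
  have k11 := blue_of B hb 4 4 (by omega) (by omega) (by omega)
  have k12 := red_of B hr 1 1 1 (by omega) (by omega) (by omega) (by omega)
  have k13 := red_of B hr 1 1 6 (by omega) (by omega) (by omega) (by omega)
  have k14 := red_of B hr 1 3 1 (by omega) (by omega) (by omega) (by omega)
  have k15 := red_of B hr 1 3 3 (by omega) (by omega) (by omega) (by omega)
  have k16 := red_of B hr 1 3 4 (by omega) (by omega) (by omega) (by omega)
  have k17 := red_of B hr 1 4 1 (by omega) (by omega) (by omega) (by omega)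
  have k18 := red_of B hr 2 2 2 (by omega) (by omega) (by omega) (by omega)
  have k19 := red_of B hr 2 3 2 (by omega) (by omega) (by omega) (by omega)
  have k20 := red_of B hr 2 3 3 (by omega) (by omega) (by omega) (by omega)
  clear hb hr _hB
  norm_num only at *
  by_cases h1 : 1 ∈ B <;> by_cases h2 : 2 ∈ B <;> by_cases h3 : 3 ∈ B <;>
    by_cases h4 : 4 ∈ B <;> by_cases h5 : 5 ∈ B <;> grind

theorem lower_blue : ∀ V ∈ (Finset.Icc 1 8).powersetCard 3,
    ¬ ∀ i ∈ V, ∀ j ∈ V, i < j → j - i ∈ ({1, 4, 7} : Finset ℕ) := by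
  decide +kernel

theorem lower_red : ∀ V ∈ (Finset.Icc 1 8).powersetCard 4,
    ¬ ∀ i ∈ V, ∀ j ∈ V, i < j → j - i ∉ ({1, 4, 7} : Finset ℕ) := by
  decide +kernel

/-- The coloring `{1, 4, 7}`, cut down to `{1, …, N - 1}`, has no bad clique for `N ≤ 8`. -/
theorem lower_bound (N : ℕ) (hN : N ≤ 8) :
    ∃ B : Set ℕ, B ⊆ Set.Icc 1 (N - 1) ∧ ¬ HasBlueClique B N 3 ∧ ¬ HasRedClique B N 4 := by
  refine ⟨{x | x ∈ ({1, 4, 7} : Finset ℕ) ∧ x ∈ Set.Icc 1 (N - 1)}, fun x hx => hx.2, ?_, ?_⟩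
  · rintro ⟨V, hV, hc, h⟩
    refine lower_blue V ?_ fun i hi j hj hij => (h i hi j hj hij).1
    rw [Finset.mem_powersetCard]
    exact ⟨fun v hv => Finset.mem_Icc.mpr ⟨(hV v hv).1, (hV v hv).2.trans hN⟩, hc⟩
  · rintro ⟨V, hV, hc, h⟩
    refine lower_red V ?_ fun i hi j hj hij hm => h i hi j hj hij ⟨hm, ?_⟩
    · rw [Finset.mem_powersetCard]
      exact ⟨fun v hv => Finset.mem_Icc.mpr ⟨(hV v hv).1, (hV v hv).2.trans hN⟩, hc⟩
    · have h1 := hV i hi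
      have h2 := hV j hj
      constructor <;> omega

/-- The difference Ramsey number `D(3, 4)` equals `9`: for every `B ⊆ {1, …, 8}` the
difference coloring of `K_9` contains a blue `K_3` or a red `K_4`, and there is a
`B ⊆ {1, …, 7}` whose difference coloring of `K_8` contains neither. -/
theorem diffRamsey_3_4 :
    diffRamseyNumber 3 4 = 9 ∧
    (∀ B : Set ℕ, B ⊆ Set.Icc 1 8 → HasBlueClique B 9 3 ∨ HasRedClique B 9 4) ∧
    (∃ B : Set ℕ, B ⊆ Set.Icc 1 7 ∧ ¬ HasBlueClique B 8 3 ∧ ¬ HasRedClique B 8 4) := by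
  refine ⟨?_, upper_bound, lower_bound 8 le_rfl⟩
  apply le_antisymm
  · exact Nat.sInf_le upper_bound
  · refine le_csInf ⟨9, upper_bound⟩ fun N hN => ?_
    by_contra hlt
    obtain ⟨B, hB, hb, hr⟩ := lower_bound N (by omega)
    exact (hN B hB).elim hb hr
end

section
/- The difference Ramsey number D(3, 6) equals 17: for every B ⊆ {1, …, 16} the difference coloring of the complete graph on {1, …, 17} contains a blue K_3 or a red K_6, and there exists B ⊆ {1, …, 15} such that the difference coloring of the complete graph on {1, …, 16} contains neither a blue K_3 nor a red K_6. -/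
/-- Decision trees certifying the upper bound. -/
inductive DTree
  | b : ℕ → ℕ → DTree
  | r : List ℕ → DTree
  | n : ℕ → DTree → DTree → DTree

/-- Certificate checker: `bl` are the known blue and `rd` the known red differences. -/
def DTree.check : DTree → List ℕ → List ℕ → Bool
  | .b a c, bl, _ => decide (1 ≤ a ∧ 1 ≤ c ∧ a + c ≤ 16 ∧ a ∈ bl ∧ c ∈ bl ∧ a + c ∈ bl)
  | .r l, _, rd => decide ((∀ v ∈ l, 1 ≤ v ∧ v ≤ 17) ∧ l.length = 6 ∧ l.Nodup ∧
      ∀ i ∈ l, ∀ j ∈ l, i < j → j - i ∈ rd)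
  | .n d s t, bl, rd => s.check (d :: bl) rd && t.check bl (d :: rd)

theorem DTree.check_sound (B : Set ℕ) (t : DTree) : ∀ bl rd : List ℕ,
    t.check bl rd = true → (∀ x ∈ bl, x ∈ B) → (∀ x ∈ rd, x ∉ B) →
    HasBlueClique B 17 3 ∨ HasRedClique B 17 6 := by
  induction t with
  | b a c =>
    intro bl rd h hb hr
    simp only [DTree.check, decide_eq_true_eq] at h
    obtain ⟨h1, h2, h3, h4, h5, h6⟩ := h
    left
    refine ⟨{1, 1 + a, 1 + a + c}, ?_, ?_, ?_⟩
    · intro v hv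
      simp only [Finset.mem_insert, Finset.mem_singleton] at hv
      omega
    · rw [Finset.card_eq_three]
      exact ⟨1, 1 + a, 1 + a + c, by omega, by omega, by omega, rfl⟩
    · intro i hi j hj hij
      simp only [Finset.mem_insert, Finset.mem_singleton] at hi hj
      have : j - i = a ∨ j - i = c ∨ j - i = a + c := by omega
      rcases this with h | h | h <;> rw [h] <;> apply hb <;> assumption
  | r l =>
    intro bl rd h hb hr
    simp only [DTree.check, decide_eq_true_eq] at h
    obtain ⟨h1, h2, h3, h4⟩ := h
    right
    refine ⟨l.toFinset, ?_, ?_, ?_⟩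
    · intro v hv
      exact h1 v (List.mem_toFinset.1 hv)
    · rw [List.toFinset_card_of_nodup h3, h2]
    · intro i hi j hj hij
      exact hr _ (h4 i (List.mem_toFinset.1 hi) j (List.mem_toFinset.1 hj) hij)
  | n d s t ihs iht =>
    intro bl rd h hb hr
    simp only [DTree.check, Bool.and_eq_true] at h
    by_cases hd : d ∈ B
    · exact ihs _ _ h.1 (by simpa [hd] using hb) hr
    · exact iht _ _ h.2 hb (by simpa [hd] using hr)

/-- The certificate for the upper bound. -/
def upperTree : DTree :=
  .n 2 (.n 4 (.b 2 2) (.n 1 (.b 1 1) (.n 5 (.n 10 (.b 5 5) (.n 7 (.b 2 5) (.n 3 (.b 2 3) (.n 6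
  (.n 12 (.b 6 6) (.n 11 (.b 5 6) (.n 8 (.b 2 6) (.r [1, 2, 5, 9, 12, 13])))) (.n 13 (.n 8 (.b
  5 8) (.n 11 (.b 2 11) (.r [1, 4, 5, 8, 11, 12]))) (.r [1, 4, 7, 8, 11, 14])))))) (.n 6 (.n 12
  (.b 6 6) (.n 3 (.b 3 3) (.n 8 (.b 2 6) (.n 7 (.n 14 (.b 7 7) (.n 13 (.b 6 7) (.n 9 (.b 2 7)
  (.r [1, 5, 6, 9, 10, 14])))) (.n 11 (.n 9 (.b 2 9) (.r [1, 2, 5, 6, 9, 10])) (.r [1, 4, 5, 8,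
  9, 12])))))) (.n 10 (.n 12 (.b 2 10) (.n 8 (.b 2 8) (.n 7 (.n 14 (.b 7 7) (.n 3 (.b 3 7) (.n
  9 (.b 2 7) (.r [1, 4, 5, 9, 10, 13])))) (.n 13 (.n 3 (.b 3 10) (.n 9 (.n 11 (.b 2 9) (.r [1,
  4, 5, 8, 9, 12])) (.r [1, 2, 5, 6, 9, 10]))) (.n 14 (.n 11 (.n 3 (.b 3 11) (.n 9 (.b 2 9) (.r
  [1, 2, 5, 6, 9, 10]))) (.r [1, 2, 7, 8, 13, 14])) (.r [1, 2, 8, 9, 14, 15])))))) (.n 9 (.n 11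
  (.b 2 9) (.n 16 (.n 8 (.b 8 8) (.n 7 (.b 2 7) (.n 15 (.n 12 (.n 3 (.b 3 9) (.r [1, 4, 5, 8,
  9, 12])) (.r [1, 2, 7, 8, 12, 13])) (.r [1, 5, 6, 11, 12, 16])))) (.r [1, 6, 7, 11, 12,
  17]))) (.n 14 (.n 11 (.n 7 (.b 7 7) (.n 3 (.b 3 11) (.n 15 (.n 8 (.n 13 (.b 2 11) (.r [1, 4,
  7, 8, 11, 14])) (.r [1, 2, 5, 6, 9, 10])) (.r [1, 6, 7, 10, 11, 16])))) (.r [1, 2, 6, 7, 11,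
  12])) (.r [1, 5, 6, 10, 11, 15])))))))) (.n 6 (.n 12 (.b 6 6) (.n 3 (.b 3 3) (.n 5 (.n 11 (.b
  5 6) (.n 10 (.b 5 5) (.n 1 (.b 1 5) (.n 8 (.n 16 (.b 8 8) (.n 14 (.b 6 8) (.n 13 (.b 5 8) (.r
  [1, 2, 3, 13, 14, 15])))) (.n 9 (.n 15 (.b 6 9) (.n 14 (.b 5 9) (.n 13 (.n 7 (.b 6 7) (.n 4
  (.b 4 5) (.r [1, 5, 8, 9, 12, 16]))) (.r [1, 2, 3, 13, 14, 15])))) (.r [1, 2, 3, 11, 12,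
  13])))))) (.n 7 (.n 14 (.b 7 7) (.n 13 (.b 6 7) (.n 1 (.b 1 6) (.n 4 (.n 11 (.b 4 7) (.n 15
  (.n 10 (.b 4 6) (.r [1, 2, 3, 13, 14, 15])) (.r [1, 2, 3, 14, 15, 16]))) (.r [1, 2, 3, 4, 5,
  6]))))) (.n 10 (.n 16 (.b 6 10) (.n 4 (.b 4 6) (.n 1 (.n 11 (.b 1 10) (.n 9 (.b 1 9) (.r [1,
  3, 5, 8, 10, 12]))) (.r [1, 2, 3, 4, 5, 6])))) (.n 8 (.n 16 (.b 8 8) (.n 14 (.b 6 8) (.n 9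
  (.n 15 (.b 6 9) (.n 4 (.b 4 4) (.n 1 (.b 1 8) (.r [1, 2, 3, 4, 5, 6])))) (.r [1, 3, 8, 10,
  15, 17])))) (.r [1, 3, 6, 8, 11, 13]))))))) (.n 8 (.n 16 (.b 8 8) (.n 4 (.b 4 4) (.n 5 (.n 13
  (.b 5 8) (.n 10 (.b 5 5) (.n 3 (.b 3 5) (.n 7 (.n 15 (.b 7 8) (.n 14 (.b 7 7) (.n 12 (.b 5 7)
  (.n 1 (.b 1 7) (.r [1, 2, 3, 15, 16, 17]))))) (.r [1, 4, 7, 11, 14, 17]))))) (.n 1 (.n 9 (.b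
  1 8) (.n 7 (.b 1 7) (.n 11 (.n 3 (.b 3 8) (.n 12 (.b 1 11) (.r [1, 4, 6, 8, 10, 13]))) (.r
  [1, 6, 8, 10, 12, 17])))) (.n 3 (.n 11 (.b 3 8) (.n 10 (.n 13 (.b 3 10) (.n 7 (.b 3 7) (.n 9
  (.n 12 (.b 3 9) (.r [1, 2, 7, 8, 13, 14])) (.r [1, 3, 5, 10, 12, 14])))) (.r [1, 6, 7, 11,
  12, 17]))) (.r [1, 2, 3, 4, 5, 6])))))) (.n 10 (.n 5 (.b 5 5) (.n 1 (.n 11 (.b 1 10) (.n 9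
  (.b 1 9) (.n 3 (.n 13 (.b 3 10) (.n 7 (.b 3 7) (.n 4 (.b 1 3) (.r [1, 3, 5, 10, 12, 14]))))
  (.n 13 (.n 14 (.b 1 13) (.r [1, 4, 7, 9, 12, 15])) (.r [1, 3, 6, 9, 12, 14]))))) (.n 3 (.n 13
  (.b 3 10) (.n 7 (.b 3 7) (.n 14 (.n 12 (.n 9 (.b 3 9) (.r [1, 2, 3, 8, 9, 10])) (.r [1, 6, 7,
  8, 13, 14])) (.r [1, 7, 8, 9, 14, 15])))) (.n 11 (.n 4 (.n 15 (.b 4 11) (.n 14 (.b 4 10) (.n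
  7 (.b 4 7) (.n 9 (.n 13 (.b 4 9) (.r [1, 2, 8, 9, 15, 16])) (.r [1, 2, 3, 8, 9, 10]))))) (.r
  [1, 2, 3, 4, 5, 6])) (.r [1, 4, 6, 7, 9, 12]))))) (.n 4 (.n 7 (.n 14 (.b 7 7) (.n 11 (.b 4 7)
  (.n 3 (.b 3 4) (.n 5 (.n 12 (.b 5 7) (.n 9 (.b 4 5) (.n 1 (.b 1 4) (.r [1, 2, 3, 11, 12,
  13])))) (.r [1, 4, 7, 9, 12, 15]))))) (.n 1 (.n 5 (.b 1 4) (.n 3 (.b 1 3) (.n 13 (.n 12 (.b 1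
  12) (.r [1, 3, 6, 8, 11, 13])) (.r [1, 4, 6, 9, 11, 14])))) (.n 9 (.n 13 (.b 4 9) (.n 5 (.b 4
  5) (.n 3 (.n 14 (.n 12 (.b 3 9) (.r [1, 6, 7, 8, 13, 14])) (.r [1, 7, 8, 9, 14, 15])) (.r [1,
  4, 6, 9, 11, 14])))) (.r [1, 2, 3, 9, 10, 11])))) (.r [1, 3, 5, 7, 9, 11])))))

set_option maxRecDepth 100000 in
theorem upperTree_check : upperTree.check [] [] = true := by decide +kernel

/-- Exhaustive search: `true` means that no `k`-subset of `{1, …, i}` with all differences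
satisfying `p` is compatible with the already chosen larger vertices `S`. -/
def noClique (p : ℕ → Bool) : ℕ → List ℕ → ℕ → Bool
  | _, _, 0 => false
  | 0, _, _ + 1 => true
  | i + 1, S, k + 1 => noClique p i S (k + 1) &&
      (S.any (fun s => !p (s - (i + 1))) || noClique p i ((i + 1) :: S) k)

theorem noClique_sound (p : ℕ → Bool) : ∀ (i : ℕ) (S : List ℕ) (k : ℕ),
    noClique p i S k = true → ∀ V : Finset ℕ, (∀ v ∈ V, 1 ≤ v ∧ v ≤ i) → V.card = k →
    (∀ a ∈ V, ∀ c ∈ V, a < c → p (c - a) = true) →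
    (∀ a ∈ V, ∀ s ∈ S, p (s - a) = true) → False := by
  intro i
  induction i with
  | zero =>
    intro S k h V hV hk _ _
    cases k with
    | zero => simp [noClique] at h
    | succ k =>
      obtain ⟨v, hv⟩ : V.Nonempty := by rw [← Finset.card_pos]; omega
      have := hV v hv
      omega
  | succ i ih =>
    intro S k h V hV hk hp hS
    cases k with
    | zero => simp [noClique] at h
    | succ k =>
      simp only [noClique, Bool.and_eq_true, Bool.or_eq_true] at h
      obtain ⟨h1, h2⟩ := h
      by_cases hm : i + 1 ∈ V
      · rcases h2 with h2 | h2
        · rw [List.any_eq_true] at h2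
          obtain ⟨s, hs, hn⟩ := h2
          rw [hS _ hm s hs] at hn
          simp at hn
        · refine ih _ _ h2 (V.erase (i + 1)) ?_ ?_ ?_ ?_
          · intro v hv
            rw [Finset.mem_erase] at hv
            have := hV v hv.2
            omega
          · rw [Finset.card_erase_of_mem hm]; omega
          · intro a ha c hc
            exact hp a (Finset.mem_of_mem_erase ha) c (Finset.mem_of_mem_erase hc)
          · intro a ha s hs
            rw [Finset.mem_erase] at ha
            rcases List.mem_cons.1 hs with rfl | hs
            · have := hV a ha.2
              exact hp a ha.2 _ hm (by omega)
            · exact hS a ha.2 s hs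
      · refine ih _ _ h1 V ?_ hk hp hS
        intro v hv
        have := hV v hv
        have : v ≠ i + 1 := fun e => hm (e ▸ hv)
        omega

/-- The lower-bound set of blue differences. -/
def lowerB : List ℕ := [1, 3, 8, 13]

set_option maxRecDepth 100000 in
theorem lower_blue_s8 : noClique (fun d => decide (d ∈ lowerB)) 16 [] 3 = true := by
  decide +kernel

set_option maxRecDepth 100000 in
theorem lower_red_s8 : noClique (fun d => !decide (d ∈ lowerB)) 16 [] 6 = true := by
  decide +kernel

theorem lower_all (N : ℕ) (hN : N ≤ 16) :
    ∃ B : Set ℕ, B ⊆ Set.Icc 1 (N - 1) ∧ ¬ HasBlueClique B N 3 ∧ ¬ HasRedClique B N 6 := by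
  refine ⟨{d | d ∈ lowerB ∧ d ∈ Set.Icc 1 (N - 1)}, fun d hd => hd.2, ?_, ?_⟩
  · rintro ⟨V, hV, hc, h⟩
    refine noClique_sound _ _ _ _ lower_blue_s8 V ?_ hc ?_ (by simp)
    · intro v hv
      have := hV v hv
      omega
    · intro a ha c hc hac
      exact decide_eq_true (h a ha c hc hac).1
  · rintro ⟨V, hV, hc, h⟩
    refine noClique_sound _ _ _ _ lower_red_s8 V ?_ hc ?_ (by simp)
    · intro v hv
      have := hV v hv
      omega
    · intro a ha c hc hac
      have h1 := hV a ha
      have h2 := hV c hc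
      have h3 : c - a ∉ lowerB := fun hm =>
        h a ha c hc hac ⟨hm, by rw [Set.mem_Icc]; omega⟩
      simp [h3]

theorem upper_all (B : Set ℕ) : HasBlueClique B 17 3 ∨ HasRedClique B 17 6 :=
  DTree.check_sound B upperTree [] [] upperTree_check (by simp) (by simp)

/-- The difference Ramsey number `D(3, 6)` equals `17`: for every `B ⊆ {1, …, 16}` the
difference coloring of `K_17` contains a blue `K_3` or a red `K_6`, and there is a
`B ⊆ {1, …, 15}` whose difference coloring of `K_16` contains neither. -/
theorem diffRamsey_3_6 :
    diffRamseyNumber 3 6 = 17 ∧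
    (∀ B : Set ℕ, B ⊆ Set.Icc 1 16 → HasBlueClique B 17 3 ∨ HasRedClique B 17 6) ∧
    (∃ B : Set ℕ, B ⊆ Set.Icc 1 15 ∧ ¬ HasBlueClique B 16 3 ∧ ¬ HasRedClique B 16 6) := by
  refine ⟨?_, fun B _ => upper_all B, lower_all 16 le_rfl⟩
  unfold diffRamseyNumber
  apply le_antisymm
  · exact Nat.sInf_le (fun B _ => upper_all B)
  · refine le_csInf ⟨17, fun B _ => upper_all B⟩ ?_
    intro N hN
    by_contra hlt
    obtain ⟨B, hB, h1, h2⟩ := lower_all N (by omega)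
    rcases hN B hB with h | h
    · exact h1 h
    · exact h2 h
end

section
/- The 3-color difference Ramsey number D(3, 3, 3) equals 15: for every coloring c of {1, …, 14} by three colors, the difference coloring of the complete graph on {1, …, 15} contains a monochromatic triangle (three vertices all of whose pairwise differences receive the same color), and there exists a 3-coloring of {1, …, 13} such that the difference coloring of the complete graph on {1, …, 14} contains no monochromatic triangle. -/
/-- A monochromatic `m`-clique in color `t` of the difference coloring of `K_n`
determined by the coloring `c` of the differences: a set of `m` vertices in `{1, …, n}`
all of whose pairwise differences receive color `t`. -/
def HasMonoClique (c : ℕ → Fin 3) (t : Fin 3) (n m : ℕ) : Prop :=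
  ∃ V : Finset ℕ, (∀ v ∈ V, 1 ≤ v ∧ v ≤ n) ∧ V.card = m ∧
    ∀ i ∈ V, ∀ j ∈ V, i < j → c (j - i) = t

/-- The 3-color difference Ramsey number `D(3, 3, 3)`: the least `N` such that every
3-coloring of the differences `{1, …, N-1}` yields a monochromatic triangle in the
difference coloring of `K_N`. -/
noncomputable def diffRamsey333 : ℕ :=
  sInf {N | ∀ c : ℕ → Fin 3, ∃ t : Fin 3, HasMonoClique c t N 3}

/-- Coloring number `l.length + 1` with `x` creates a monochromatic Schur triple. -/
def conflict (l : List (Fin 3)) (x : Fin 3) : Bool :=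
  (List.range l.length).any fun i => l.getD i 0 == x && l.getD (l.length - 1 - i) 0 == x

/-- Exhaustive search: every extension of `l` by `n` colors hits a conflict. -/
def dfs : ℕ → List (Fin 3) → Bool
  | 0, _ => false
  | n + 1, l => [0, 1, 2].all fun x => conflict l x || dfs n (l ++ [x])

theorem dfs_sound (c : ℕ → Fin 3) (n : ℕ) : ∀ k, k + n ≤ 14 →
    dfs n ((List.range k).map fun i => c (i + 1)) = true →
    ∃ a b, 1 ≤ a ∧ 1 ≤ b ∧ a + b ≤ 14 ∧ c a = c (a + b) ∧ c b = c (a + b) := by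
  induction n with
  | zero => intro k _ h; simp [dfs] at h
  | succ n ih =>
    intro k hk h
    have hx : ∀ x : Fin 3, x ∈ [(0 : Fin 3), 1, 2] := by decide
    have h1 := (List.all_eq_true.mp h) (c (k + 1)) (hx _)
    rw [Bool.or_eq_true] at h1
    rcases h1 with h1 | h1
    · obtain ⟨i, hi, h2⟩ := List.any_eq_true.mp h1
      simp only [List.length_map, List.length_range, List.mem_range] at hi h2
      rw [Bool.and_eq_true, beq_iff_eq, beq_iff_eq] at h2
      obtain ⟨h2, h3⟩ := h2
      have hj : k - 1 - i < k := by omega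
      rw [List.getD_eq_getElem _ _ (by simpa using hi)] at h2
      rw [List.getD_eq_getElem _ _ (by simpa using hj)] at h3
      simp only [List.getElem_map, List.getElem_range] at h2 h3
      have e : i + 1 + (k - 1 - i + 1) = k + 1 := by omega
      exact ⟨i + 1, k - 1 - i + 1, by omega, by omega, by omega, by rw [e, h2], by rw [e, h3]⟩
    · apply ih (k + 1) (by omega)
      rw [List.range_succ, List.map_append]
      exact h1

theorem upper (c : ℕ → Fin 3) : ∃ t : Fin 3, HasMonoClique c t 15 3 := by
  obtain ⟨a, b, ha, hb, hab, h1, h2⟩ := dfs_sound c 14 0 (by norm_num)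
    (show dfs 14 [] = true by decide +kernel)
  refine ⟨c (a + b), {1, 1 + a, 1 + a + b}, ?_, ?_, ?_⟩
  · intro v hv
    simp only [Finset.mem_insert, Finset.mem_singleton] at hv
    omega
  · rw [Finset.card_eq_three]
    exact ⟨1, 1 + a, 1 + a + b, by omega, by omega, by omega, rfl⟩
  · intro i hi j hj hij
    simp only [Finset.mem_insert, Finset.mem_singleton] at hi hj
    have : j - i = a ∨ j - i = b ∨ j - i = a + b := by omega
    rcases this with h | h | h <;> rw [h]
    · exact h1
    · exact h2

/-- The Schur coloring of `{1, …, 13}`. -/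
def schurCol (n : ℕ) : Fin 3 :=
  [0, 0, 1, 1, 0, 2, 2, 2, 2, 2, 0, 1, 1, 0].getD n 0

theorem schurCol_free_fin : ∀ a b : Fin 14, 1 ≤ a.val ∧ 1 ≤ b.val ∧ a.val + b.val ≤ 13 →
    ¬ (schurCol a.val = schurCol (a.val + b.val) ∧
      schurCol b.val = schurCol (a.val + b.val)) := by
  decide +kernel

theorem schurCol_free (a : ℕ) (ha : a < 14) (b : ℕ) (hb : b < 14) (h1 : 1 ≤ a) (h2 : 1 ≤ b)
    (h3 : a + b ≤ 13) :
    ¬ (schurCol a = schurCol (a + b) ∧ schurCol b = schurCol (a + b)) :=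
  schurCol_free_fin ⟨a, ha⟩ ⟨b, hb⟩ ⟨h1, h2, h3⟩

theorem lower (t : Fin 3) : ¬ HasMonoClique schurCol t 14 3 := by
  rintro ⟨V, hV, hc, h⟩
  obtain ⟨x, y, z, hx, hy, hz, hxy, hyz⟩ :
      ∃ x y z, x ∈ V ∧ y ∈ V ∧ z ∈ V ∧ x < y ∧ y < z := by
    refine ⟨V.orderEmbOfFin hc 0, V.orderEmbOfFin hc 1, V.orderEmbOfFin hc 2,
      V.orderEmbOfFin_mem hc _, V.orderEmbOfFin_mem hc _, V.orderEmbOfFin_mem hc _, ?_, ?_⟩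
    · exact (V.orderEmbOfFin hc).strictMono (by decide)
    · exact (V.orderEmbOfFin hc).strictMono (by decide)
  have h1 := h x hx y hy hxy
  have h2 := h y hy z hz hyz
  have h3 := h x hx z hz (hxy.trans hyz)
  have := hV x hx
  have := hV z hz
  have e : y - x + (z - y) = z - x := by omega
  refine schurCol_free (y - x) (by omega) (z - y) (by omega) (by omega) (by omega) (by omega) ?_
  rw [e, h1, h2, h3]
  exact ⟨rfl, rfl⟩

/-- `D(3, 3, 3) = 15`: every 3-coloring of the differences `{1, …, 14}` yields a
monochromatic triangle in the difference coloring of `K_15`, and some 3-coloring of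
`{1, …, 13}` yields no monochromatic triangle in the difference coloring of `K_14`. -/
theorem diffRamsey_3_3_3 :
    diffRamsey333 = 15 ∧
    (∀ c : ℕ → Fin 3, ∃ t : Fin 3, HasMonoClique c t 15 3) ∧
    (∃ c : ℕ → Fin 3, ∀ t : Fin 3, ¬ HasMonoClique c t 14 3) := by
  refine ⟨?_, upper, schurCol, lower⟩
  apply le_antisymm
  · exact Nat.sInf_le upper
  · refine le_csInf ⟨15, upper⟩ ?_
    intro N hN
    by_contra hlt
    obtain ⟨t, V, hV, hc, h⟩ := hN schurCol
    exact lower t ⟨V, fun v hv => ⟨(hV v hv).1, by have := (hV v hv).2; omega⟩, hc, h⟩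
end
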